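/- Let G be a groupoid and let R be a G-graded ring. Then R is nearly epsilon-strongly G-graded if and only if for all g ∈ G and r ∈ R_g, there exist elements ε_{g,g⁻¹}(r) ∈ R_g R_{g⁻¹} and ε'_{g⁻¹,g}(r) ∈ R_{g⁻¹} R_g such that ε_{g,g⁻¹}(r) r = r = r ε'_{g⁻¹,g}(r). -/

import Mathlib

open scoped Pointwise
open CategoryTheory

/-- The set of morphisms of a groupoid `G` (with object type `Ob`), encoded as triples
`⟨a, b, g⟩` where `g : a ⟶ b`; thus `d(⟨a,b,g⟩) = a` and `c(⟨a,b,g⟩) = b`. -/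
def GroupoidMor (Ob : Type*) [Groupoid Ob] : Type _ := Σ a b : Ob, a ⟶ b

/-- The inverse morphism: if `g : a ⟶ b` then `g⁻¹ : b ⟶ a`. -/
def GroupoidMor.inv {Ob : Type*} [Groupoid Ob] (g : GroupoidMor Ob) : GroupoidMor Ob :=
  ⟨g.2.1, g.1, Groupoid.inv g.2.2⟩

/-- The product `A B` of two additive subgroups of a ring: the additive subgroup
generated by all products `a * b` with `a ∈ A`, `b ∈ B`. -/
def subgroupMul {R : Type*} [NonUnitalRing R] (A B : AddSubgroup R) : AddSubgroup R :=
  AddSubgroup.closure ((A : Set R) * (B : Set R))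

/-- A subset `P` of `R` (closed under multiplication) is a unital ring:
it has a two-sided multiplicative identity element. -/
def HasUnity {R : Type*} [NonUnitalRing R] (P : AddSubgroup R) : Prop :=
  ∃ u ∈ P, ∀ x ∈ P, u * x = x ∧ x * u = x

/-- A subset `P` of `R` is an s-unital ring: `x ∈ Px` and `x ∈ xP` for every `x ∈ P`. -/
def IsSUnital {R : Type*} [NonUnitalRing R] (P : AddSubgroup R) : Prop :=
  ∀ x ∈ P, (∃ u ∈ P, u * x = x) ∧ (∃ v ∈ P, x * v = x)

/-- A subset `P` of `R` is a von Neumann regular ring: `r ∈ rPr` for every `r ∈ P`. -/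
def IsVonNeumannRegular {R : Type*} [NonUnitalRing R] (P : AddSubgroup R) : Prop :=
  ∀ r ∈ P, ∃ x ∈ P, r = r * x * r

/-- `R` is a `G`-graded ring via the family `𝒜` of additive subgroups indexed by the
morphisms of the groupoid `G`: `R = ⊕_{g ∈ G} R_g` (internal direct sum),
`R_g R_h ⊆ R_{gh}` for composable pairs `(g,h)` (i.e. `d(g) = c(h)`), and
`R_g R_h = {0}` for non-composable pairs. -/
structure IsGroupoidGrading {Ob R : Type*} [Groupoid Ob] [DecidableEq (GroupoidMor Ob)]
    [NonUnitalRing R] (𝒜 : GroupoidMor Ob → AddSubgroup R) : Prop where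
  internal : DirectSum.IsInternal 𝒜
  mul_mem : ∀ (a b c : Ob) (g : b ⟶ c) (h : a ⟶ b),
    ∀ x ∈ 𝒜 ⟨b, c, g⟩, ∀ y ∈ 𝒜 ⟨a, b, h⟩, x * y ∈ 𝒜 ⟨a, c, h ≫ g⟩
  mul_eq_zero : ∀ g h : GroupoidMor Ob, g.1 ≠ h.2.1 →
    ∀ x ∈ 𝒜 g, ∀ y ∈ 𝒜 h, x * y = 0

/-- `R` is symmetrically `G`-graded: `R_g = R_g R_{g⁻¹} R_g` for every morphism `g`. -/
def SymmetricallyGroupoidGraded {Ob R : Type*} [Groupoid Ob] [NonUnitalRing R]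
    (𝒜 : GroupoidMor Ob → AddSubgroup R) : Prop :=
  ∀ g : GroupoidMor Ob, 𝒜 g = subgroupMul (subgroupMul (𝒜 g) (𝒜 g.inv)) (𝒜 g)

/-- `R` is epsilon-strongly `G`-graded: symmetrically `G`-graded and `R_g R_{g⁻¹}`
is unital for every morphism `g`. -/
def EpsilonStronglyGroupoidGraded {Ob R : Type*} [Groupoid Ob] [NonUnitalRing R]
    (𝒜 : GroupoidMor Ob → AddSubgroup R) : Prop :=
  SymmetricallyGroupoidGraded 𝒜 ∧ ∀ g : GroupoidMor Ob, HasUnity (subgroupMul (𝒜 g) (𝒜 g.inv))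

/-- `R` is nearly epsilon-strongly `G`-graded: symmetrically `G`-graded and
`R_g R_{g⁻¹}` is s-unital for every morphism `g`. -/
def NearlyEpsilonStronglyGroupoidGraded {Ob R : Type*} [Groupoid Ob] [NonUnitalRing R]
    (𝒜 : GroupoidMor Ob → AddSubgroup R) : Prop :=
  SymmetricallyGroupoidGraded 𝒜 ∧
    ∀ g : GroupoidMor Ob, IsSUnital (subgroupMul (𝒜 g) (𝒜 g.inv))

section SubgroupMul

variable {R : Type*} [NonUnitalRing R]

lemma mul_mem_subgroupMul {A B : AddSubgroup R} {a b : R} (ha : a ∈ A) (hb : b ∈ B) :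
    a * b ∈ subgroupMul A B :=
  AddSubgroup.subset_closure (Set.mul_mem_mul ha hb)

lemma subgroupMul_le {A B C : AddSubgroup R} :
    subgroupMul A B ≤ C ↔ ∀ a ∈ A, ∀ b ∈ B, a * b ∈ C := by
  rw [subgroupMul, AddSubgroup.closure_le]
  exact Set.mul_subset_iff

lemma subgroupMul_assoc_le (A B C : AddSubgroup R) :
    subgroupMul (subgroupMul A B) C ≤ subgroupMul A (subgroupMul B C) := by
  rw [subgroupMul_le]
  intro p hp c hc
  have h : subgroupMul A B ≤
      (subgroupMul A (subgroupMul B C)).comap (AddMonoidHom.mulRight c) := by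
    rw [subgroupMul_le]
    intro a ha b hb
    rw [AddSubgroup.mem_comap, AddMonoidHom.mulRight_apply, mul_assoc]
    exact mul_mem_subgroupMul ha (mul_mem_subgroupMul hb hc)
  exact h hp

/-- Local left units on a set of generators extend to the additive subgroup it generates,
provided that they exist for all the elements `x - u * x`. -/
lemma exists_left_unit_of_mem_closure {P : AddSubgroup R} (hP : ∀ x ∈ P, ∀ y ∈ P, x * y ∈ P)
    {X : Set R} (hX : ∀ x ∈ X, ∀ u ∈ P, ∃ v ∈ P, v * (x - u * x) = x - u * x)
    {r : R} (hr : r ∈ AddSubgroup.closure X) : ∃ v ∈ P, v * r = r := by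
  suffices h : ∀ u ∈ P, ∃ v ∈ P, v * (r - u * r) = r - u * r by
    simpa using h 0 P.zero_mem
  induction hr using AddSubgroup.closure_induction with
  | mem x hx => exact hX x hx
  | zero => exact fun u _ => ⟨0, P.zero_mem, by simp⟩
  | neg x _ ih =>
    intro u hu
    obtain ⟨v, hv, h⟩ := ih u hu
    refine ⟨v, hv, ?_⟩
    rw [show -x - u * -x = -(x - u * x) by noncomm_ring, mul_neg, h]
  | add x y _ _ ihx ihy =>
    intro u hu
    obtain ⟨v, hv, h⟩ := ihx u hu
    obtain ⟨w, hw, h'⟩ := ihy (u + v - v * u) (P.sub_mem (P.add_mem hu hv) (hP v hv u hu))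
    refine ⟨w + v - w * v, P.sub_mem (P.add_mem hw hv) (hP w hw v hv), ?_⟩
    rw [← sub_eq_zero] at h h' ⊢
    calc _ = (v * (x - u * x) - (x - u * x)) - w * (v * (x - u * x) - (x - u * x))
          + (w * (y - (u + v - v * u) * y) - (y - (u + v - v * u) * y)) := by noncomm_ring
      _ = 0 := by rw [h, h']; simp

/-- Local right units on a set of generators extend to the additive subgroup it generates,
provided that they exist for all the elements `x - x * u`. -/
lemma exists_right_unit_of_mem_closure {P : AddSubgroup R} (hP : ∀ x ∈ P, ∀ y ∈ P, x * y ∈ P)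
    {X : Set R} (hX : ∀ x ∈ X, ∀ u ∈ P, ∃ v ∈ P, (x - x * u) * v = x - x * u)
    {r : R} (hr : r ∈ AddSubgroup.closure X) : ∃ v ∈ P, r * v = r := by
  suffices h : ∀ u ∈ P, ∃ v ∈ P, (r - r * u) * v = r - r * u by
    simpa using h 0 P.zero_mem
  induction hr using AddSubgroup.closure_induction with
  | mem x hx => exact hX x hx
  | zero => exact fun u _ => ⟨0, P.zero_mem, by simp⟩
  | neg x _ ih =>
    intro u hu
    obtain ⟨v, hv, h⟩ := ih u hu
    refine ⟨v, hv, ?_⟩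
    rw [show -x - -x * u = -(x - x * u) by noncomm_ring, neg_mul, h]
  | add x y _ _ ihx ihy =>
    intro u hu
    obtain ⟨v, hv, h⟩ := ihx u hu
    obtain ⟨w, hw, h'⟩ := ihy (u + v - u * v) (P.sub_mem (P.add_mem hu hv) (hP u hu v hv))
    refine ⟨w + v - v * w, P.sub_mem (P.add_mem hw hv) (hP v hv w hw), ?_⟩
    rw [← sub_eq_zero] at h h' ⊢
    calc _ = ((x - x * u) * v - (x - x * u)) - ((x - x * u) * v - (x - x * u)) * w
          + ((y - y * (u + v - u * v)) * w - (y - y * (u + v - u * v))) := by noncomm_ring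
      _ = 0 := by rw [h, h']; simp

end SubgroupMul

section Grading

variable {Ob R : Type*} [Groupoid Ob]

@[simp]
lemma GroupoidMor.inv_inv (g : GroupoidMor Ob) : g.inv.inv = g := by
  obtain ⟨a, b, f⟩ := g
  simp only [GroupoidMor.inv, Groupoid.inv_eq_inv, IsIso.inv_inv]
  rfl

variable [DecidableEq (GroupoidMor Ob)] [NonUnitalRing R] {𝒜 : GroupoidMor Ob → AddSubgroup R}

lemma IsGroupoidGrading.mul_inv_mul_mem (hgr : IsGroupoidGrading 𝒜) (g : GroupoidMor Ob)
    {x y z : R} (hx : x ∈ 𝒜 g) (hy : y ∈ 𝒜 g.inv) (hz : z ∈ 𝒜 g) : x * y * z ∈ 𝒜 g := by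
  obtain ⟨a, b, f⟩ := g
  have h := hgr.mul_mem _ _ _ _ _ _ (hgr.mul_mem _ _ _ _ _ x hx y hy) z hz
  simpa using h

lemma IsGroupoidGrading.subgroupMul_mul_mem (hgr : IsGroupoidGrading 𝒜) (g : GroupoidMor Ob)
    {p z : R} (hp : p ∈ subgroupMul (𝒜 g) (𝒜 g.inv)) (hz : z ∈ 𝒜 g) : p * z ∈ 𝒜 g := by
  have h : subgroupMul (𝒜 g) (𝒜 g.inv) ≤ (𝒜 g).comap (AddMonoidHom.mulRight z) :=
    subgroupMul_le.2 fun x hx y hy => hgr.mul_inv_mul_mem g hx hy hz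
  exact h hp

lemma IsGroupoidGrading.mul_subgroupMul_mem (hgr : IsGroupoidGrading 𝒜) (g : GroupoidMor Ob)
    {p z : R} (hz : z ∈ 𝒜 g) (hp : p ∈ subgroupMul (𝒜 g.inv) (𝒜 g)) : z * p ∈ 𝒜 g := by
  have h : subgroupMul (𝒜 g.inv) (𝒜 g) ≤ (𝒜 g).comap (AddMonoidHom.mulLeft z) := by
    refine subgroupMul_le.2 fun x hx y hy => ?_
    rw [AddSubgroup.mem_comap, AddMonoidHom.coe_mulLeft, ← mul_assoc]
    exact hgr.mul_inv_mul_mem g hz hx hy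
  exact h hp

lemma IsGroupoidGrading.subgroupMul_inv_mul_mem (hgr : IsGroupoidGrading 𝒜) (g : GroupoidMor Ob) :
    ∀ p ∈ subgroupMul (𝒜 g) (𝒜 g.inv), ∀ q ∈ subgroupMul (𝒜 g) (𝒜 g.inv),
      p * q ∈ subgroupMul (𝒜 g) (𝒜 g.inv) := by
  intro p hp q hq
  have h : subgroupMul (𝒜 g) (𝒜 g.inv) ≤
      (subgroupMul (𝒜 g) (𝒜 g.inv)).comap (AddMonoidHom.mulLeft p) := by
    refine subgroupMul_le.2 fun x hx y hy => ?_
    rw [AddSubgroup.mem_comap, AddMonoidHom.coe_mulLeft, ← mul_assoc]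
    exact mul_mem_subgroupMul (hgr.subgroupMul_mul_mem g hp hx) hy
  exact h hq

end Grading

/-- **Proposition (nearly epsilon-strong groupoid gradings).** Let `G` be a groupoid and
`R` a `G`-graded ring. Then `R` is nearly epsilon-strongly `G`-graded if and only if for
all `g ∈ G` and `r ∈ R_g` there exist `ε_{g,g⁻¹}(r) ∈ R_g R_{g⁻¹}` and
`ε'_{g⁻¹,g}(r) ∈ R_{g⁻¹} R_g` such that `ε_{g,g⁻¹}(r) r = r = r ε'_{g⁻¹,g}(r)`. -/
theorem nearlyEpsilonStronglyGroupoidGraded_iff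
    {Ob R : Type*} [Groupoid Ob] [DecidableEq (GroupoidMor Ob)] [NonUnitalRing R]
    (𝒜 : GroupoidMor Ob → AddSubgroup R) (hgr : IsGroupoidGrading 𝒜) :
    NearlyEpsilonStronglyGroupoidGraded 𝒜 ↔
      ∀ g : GroupoidMor Ob, ∀ r ∈ 𝒜 g,
        (∃ ε ∈ subgroupMul (𝒜 g) (𝒜 g.inv), ε * r = r) ∧
        (∃ ε' ∈ subgroupMul (𝒜 g.inv) (𝒜 g), r * ε' = r) := by
  constructor
  · rintro ⟨hsym, hunit⟩ g r hr
    have hr' := hr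
    rw [hsym g] at hr'
    refine ⟨exists_left_unit_of_mem_closure (hgr.subgroupMul_inv_mul_mem g) ?_ hr',
      exists_right_unit_of_mem_closure (by simpa using hgr.subgroupMul_inv_mul_mem g.inv) ?_
        (subgroupMul_assoc_le _ _ _ hr')⟩
    · rintro _ ⟨p, hp, a, -, rfl⟩ u hu
      obtain ⟨v, hv, h⟩ := (hunit g _
        (AddSubgroup.sub_mem _ hp (hgr.subgroupMul_inv_mul_mem g u hu p hp))).1
      refine ⟨v, hv, ?_⟩
      simp only [← mul_assoc u, ← sub_mul, ← mul_assoc v, h]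
    · rintro _ ⟨a, -, q, hq, rfl⟩ u hu
      have hunit' := hunit g.inv
      have hmul := hgr.subgroupMul_inv_mul_mem g.inv
      rw [GroupoidMor.inv_inv] at hunit' hmul
      obtain ⟨v, hv, h⟩ := (hunit' _ (AddSubgroup.sub_mem _ hq (hmul q hq u hu))).2
      refine ⟨v, hv, ?_⟩
      simp only [mul_assoc, ← mul_sub, h]
  · intro H
    refine ⟨fun g => le_antisymm (fun r hr => ?_) ?_, fun g x hx => ⟨?_, ?_⟩⟩
    · obtain ⟨ε, hε, h⟩ := (H g r hr).1
      rw [← h]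
      exact mul_mem_subgroupMul hε hr
    · exact subgroupMul_le.2 fun p hp z hz => hgr.subgroupMul_mul_mem g hp hz
    · refine exists_left_unit_of_mem_closure (hgr.subgroupMul_inv_mul_mem g) ?_ hx
      rintro _ ⟨a, ha, b, -, rfl⟩ u hu
      obtain ⟨v, hv, h⟩ := (H g _
        (AddSubgroup.sub_mem _ ha (hgr.subgroupMul_mul_mem g hu ha))).1
      refine ⟨v, hv, ?_⟩
      simp only [← mul_assoc u, ← sub_mul, ← mul_assoc v, h]
    · refine exists_right_unit_of_mem_closure (hgr.subgroupMul_inv_mul_mem g) ?_ hx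
      rintro _ ⟨a, -, b, hb, rfl⟩ u hu
      have hright := H g.inv
      have hmem := hgr.mul_subgroupMul_mem g.inv hb (p := u)
      rw [GroupoidMor.inv_inv] at hright hmem
      obtain ⟨v, hv, h⟩ := (hright _ (AddSubgroup.sub_mem _ hb (hmem hu))).2
      refine ⟨v, hv, ?_⟩
      simp only [mul_assoc, ← mul_sub, h]
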